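/- arXiv:1203.5952 — 3 statements merged into one kernel-verified Lean document; each statement's English description precedes it below -/
import Mathlib

section
/- Let (E₁,A₁) be a pair of real k×k matrices and (E₃,A₃) a pair of real l×l matrices, both regular (i.e. det(sE₁−A₁) ≠ 0 for some s ∈ ℂ and det(sE₃−A₃) ≠ 0 for some s ∈ ℂ), such that {λ ∈ ℂ : det(λE₁−A₁) = 0} ∩ {λ ∈ ℂ : det(λE₃−A₃) = 0} = ∅ and at least one of E₁, E₃ is invertible. Then for all real k×l matrices E₂, A₂ there exist real k×l matrices R, L satisfying the generalized Sylvester equations A₁R − LA₃ = −A₂ and E₁R − LE₃ = −E₂; consequently, with P := [[I_k, −L],[0, I_l]] and Q := [[I_k, R],[0, I_l]] (block matrices), one has P·[[E₁,E₂],[0,E₃]]·Q = diag(E₁,E₃) and P·[[A₁,A₂],[0,A₃]]·Q = diag(A₁,A₃). -/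
open Matrix

noncomputable section

/-- Entrywise complexification of a real matrix. -/
def cplx {ι κ : Type*} (M : Matrix ι κ ℝ) : Matrix ι κ ℂ :=
  M.map fun x => (x : ℂ)

/-- The matrix pair (E, A) is regular: det(sE − A) ≠ 0 for some s ∈ ℂ. -/
def RegularPair {ι : Type*} [Fintype ι] [DecidableEq ι] (E A : Matrix ι ι ℝ) : Prop :=
  ∃ s : ℂ, (s • cplx E - cplx A).det ≠ 0

/-- (E, A) is stable: sE − A is invertible for every s with Re s ≥ 0. -/
def StablePair {ι : Type*} [Fintype ι] [DecidableEq ι] (E A : Matrix ι ι ℝ) : Prop :=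
  ∀ s : ℂ, 0 ≤ s.re → IsUnit (s • cplx E - cplx A)

/-- (E, A) is antistable: E invertible and sE − A invertible for every s with Re s ≤ 0. -/
def AntistablePair {ι : Type*} [Fintype ι] [DecidableEq ι] (E A : Matrix ι ι ℝ) : Prop :=
  IsUnit E ∧ ∀ s : ℂ, s.re ≤ 0 → IsUnit (s • cplx E - cplx A)

/-- Transfer function G(s) = C (sE − A)⁻¹ B + D of the system (E, A, B, C, D). -/
def transfer {ι κm κp : Type*} [Fintype ι] [DecidableEq ι]
    (E A : Matrix ι ι ℝ) (B : Matrix ι κm ℝ) (C : Matrix κp ι ℝ) (D : Matrix κp κm ℝ)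
    (s : ℂ) : Matrix κp κm ℂ :=
  cplx C * (s • cplx E - cplx A)⁻¹ * cplx B + cplx D

/-- Spectral norm (ℓ² operator norm) of a complex matrix. -/
def spec2 {κp κm : Type*} [Fintype κp] [Fintype κm] [DecidableEq κm]
    (M : Matrix κp κm ℂ) : ℝ :=
  ‖LinearMap.toContinuousLinearMap (Matrix.toEuclideanLin M)‖

/-- Squared Frobenius norm of a complex matrix. -/
def frobSq {κp κm : Type*} [Fintype κp] [Fintype κm] (M : Matrix κp κm ℂ) : ℝ :=
  ∑ i, ∑ j, ‖M i j‖ ^ 2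

/-- `Xc`, `Xo` are controllability/observability Gramians of the system (E, A, B, C, ·). -/
def IsGramians {ι κm κp : Type*} [Fintype ι] [Fintype κm] [Fintype κp]
    (E A : Matrix ι ι ℝ) (B : Matrix ι κm ℝ) (C : Matrix κp ι ℝ)
    (Xc Xo : Matrix ι ι ℝ) : Prop :=
  Xc.IsSymm ∧ Xo.IsSymm ∧
    A * Xc * Eᵀ + E * Xc * Aᵀ + B * Bᵀ = 0 ∧
    Aᵀ * Xo * E + Eᵀ * Xo * A + Cᵀ * C = 0

/-- σ₁ ≥ 0 is the largest Hankel singular value: σ₁² is the greatest eigenvalue of XcEᵀXoE. -/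
def IsLargestHSV {ι : Type*} [Fintype ι] [DecidableEq ι]
    (E Xc Xo : Matrix ι ι ℝ) (σ1 : ℝ) : Prop :=
  0 ≤ σ1 ∧ ((σ1 : ℂ) ^ 2) ∈ spectrum ℂ (cplx (Xc * Eᵀ * Xo * E)) ∧
    ∀ μ ∈ spectrum ℂ (cplx (Xc * Eᵀ * Xo * E)), μ.re ≤ σ1 ^ 2

/-- R_γ = XoEXcEᵀ − γ²I. -/
def Rg {ι : Type*} [Fintype ι] [DecidableEq ι] (E Xc Xo : Matrix ι ι ℝ) (γ : ℝ) :
    Matrix ι ι ℝ :=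
  Xo * E * Xc * Eᵀ - γ ^ 2 • (1 : Matrix ι ι ℝ)

/-- E_γ = Eᵀ R_γ. -/
def Eg {ι : Type*} [Fintype ι] [DecidableEq ι] (E Xc Xo : Matrix ι ι ℝ) (γ : ℝ) :
    Matrix ι ι ℝ :=
  Eᵀ * Rg E Xc Xo γ

/-- C_γ = C Xc Eᵀ. -/
def Cg {ι κp : Type*} [Fintype ι] (C : Matrix κp ι ℝ) (E Xc : Matrix ι ι ℝ) :
    Matrix κp ι ℝ :=
  C * Xc * Eᵀ

/-- A_γ = −Aᵀ R_γ − Cᵀ C_γ. -/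
def Ag {ι κp : Type*} [Fintype ι] [Fintype κp] [DecidableEq ι]
    (E A : Matrix ι ι ℝ) (C : Matrix κp ι ℝ) (Xc Xo : Matrix ι ι ℝ) (γ : ℝ) :
    Matrix ι ι ℝ :=
  -(Aᵀ * Rg E Xc Xo γ) - Cᵀ * Cg C E Xc

/-- B_γ = Eᵀ Xo B. -/
def Bg {ι κm : Type*} [Fintype ι] (E Xo : Matrix ι ι ℝ) (B : Matrix ι κm ℝ) :
    Matrix ι κm ℝ :=
  Eᵀ * Xo * B

/-- The point iω on the imaginary axis. -/
def iax (ω : ℝ) : ℂ := (ω : ℂ) * Complex.I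

/-- Canonical equivalence Fin k ⊕ Fin d ≃ Fin n given k + d = n. -/
def finBlockEquiv {k d n : ℕ} (h : k + d = n) : Fin k ⊕ Fin d ≃ Fin n :=
  finSumFinEquiv.trans (finCongr h)

end

noncomputable section

/-- A submodule that contains `w` whenever it contains `(f - μ) w`, for every eigenvalue `μ` of `f`,
is the whole space. -/
theorem Submodule.eq_top_of_sub_algebraMap_apply_mem {K V : Type*} [Field K] [IsAlgClosed K]
    [AddCommGroup V] [Module K V] [FiniteDimensional K V] (f : Module.End K V)
    (U : Submodule K V)
    (h : ∀ μ, f.HasEigenvalue μ → ∀ w, (f - algebraMap K (Module.End K V) μ) w ∈ U → w ∈ U) :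
    U = ⊤ := by
  rw [eq_top_iff, ← Module.End.iSup_maxGenEigenspace_eq_top f]
  refine iSup_le fun μ w hw => ?_
  by_cases hμ : f.HasEigenvalue μ
  · obtain ⟨n, hn⟩ := (Module.End.mem_maxGenEigenspace f μ w).1 hw
    rw [← Algebra.algebraMap_eq_smul_one] at hn
    clear hw
    induction n generalizing w with
    | zero => simp_all
    | succ n ih =>
      refine h μ hμ w (ih _ ?_)
      rwa [pow_succ, Module.End.mul_apply] at hn
  · obtain ⟨n, hn⟩ := (Module.End.mem_maxGenEigenspace f μ w).1 hw
    have hbot : f.genEigenspace μ n = ⊥ := by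
      by_contra hne
      exact hμ (Module.End.hasEigenvalue_of_hasGenEigenvalue hne)
    rw [← LinearMap.mem_ker, ← Module.End.genEigenspace_nat, hbot, Submodule.mem_bot] at hn
    exact hn ▸ U.zero_mem

section GeneralizedSylvester

variable {ι κ : Type*} [Fintype ι] [DecidableEq ι] [Fintype κ] [DecidableEq κ]

/-- The homogeneous generalized Sylvester equations have only the trivial solution if the pairs
have no common eigenvalue and the first pair has invertible leading matrix. -/
theorem generalizedSylvester_homogeneous_of_isUnit_left {K : Type*} [Field K] [IsAlgClosed K]
    {E1 A1 : Matrix ι ι K} {E3 A3 : Matrix κ κ K} (hE : IsUnit E1)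
    (hdisj : ∀ μ : K, (μ • E1 - A1).det = 0 → (μ • E3 - A3).det ≠ 0)
    {R L : Matrix ι κ K} (hA : A1 * R = L * A3) (hER : E1 * R = L * E3) :
    R = 0 ∧ L = 0 := by
  have hdet := (Matrix.isUnit_iff_isUnit_det E1).1 hE
  set M := A1 * E1⁻¹
  have hM : M * E1 = A1 := Matrix.nonsing_inv_mul_cancel_right E1 A1 hdet
  have hML : M * L * E3 = L * A3 := by
    rw [Matrix.mul_assoc, ← hER, ← Matrix.mul_assoc, hM, hA]
  have htop : LinearMap.ker L.vecMulLinear = ⊤ := by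
    refine Submodule.eq_top_of_sub_algebraMap_apply_mem M.vecMulLinear _ fun μ hμ w hw => ?_
    obtain ⟨v, hv⟩ := hμ.exists_hasEigenvector
    have hvM : v ᵥ* M = μ • v := hv.apply_eq_smul
    have hdet1 : (μ • E1 - A1).det = 0 := by
      refine Matrix.exists_vecMul_eq_zero_iff.1 ⟨v, hv.2, ?_⟩
      rw [Matrix.vecMul_sub, ← hM, ← Matrix.vecMul_vecMul, hvM, Matrix.vecMul_smul,
        Matrix.smul_vecMul, sub_self]
    have hw' : (w ᵥ* M - μ • w) ᵥ* L = 0 := by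
      simpa [Module.algebraMap_end_apply, Matrix.sub_vecMul, Matrix.smul_vecMul] using hw
    have hwL : (w ᵥ* L) ᵥ* (μ • E3 - A3) = 0 := by
      have := congrArg (· ᵥ* E3) hw'
      simp only [Matrix.sub_vecMul, Matrix.smul_vecMul, Matrix.vecMul_vecMul, hML,
        Matrix.zero_vecMul] at this
      rw [Matrix.vecMul_sub, Matrix.vecMul_smul, Matrix.vecMul_vecMul, Matrix.vecMul_vecMul,
        ← neg_sub, this, neg_zero]
    exact Matrix.eq_zero_of_vecMul_eq_zero (hdisj μ hdet1) hwL
  have hL : L = 0 := by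
    ext i j
    have : Pi.single i 1 ∈ LinearMap.ker L.vecMulLinear := htop ▸ Submodule.mem_top
    simpa using congrFun (LinearMap.mem_ker.1 this) j
  refine ⟨?_, hL⟩
  rw [← Matrix.nonsing_inv_mul_cancel_left E1 R hdet, hER, hL, Matrix.zero_mul, Matrix.mul_zero]

/-- The homogeneous generalized Sylvester equations have only the trivial solution if the pairs
have no common eigenvalue and one of the leading matrices is invertible. -/
theorem generalizedSylvester_homogeneous {K : Type*} [Field K] [IsAlgClosed K]
    {E1 A1 : Matrix ι ι K} {E3 A3 : Matrix κ κ K} (hE : IsUnit E1 ∨ IsUnit E3)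
    (hdisj : ∀ μ : K, (μ • E1 - A1).det = 0 → (μ • E3 - A3).det ≠ 0)
    {R L : Matrix ι κ K} (hA : A1 * R = L * A3) (hER : E1 * R = L * E3) :
    R = 0 ∧ L = 0 := by
  rcases hE with hE | hE
  · exact generalizedSylvester_homogeneous_of_isUnit_left hE hdisj hA hER
  · have h := generalizedSylvester_homogeneous_of_isUnit_left (E1 := E3ᵀ) (A1 := A3ᵀ)
      (E3 := E1ᵀ) (A3 := A1ᵀ) (R := Lᵀ) (L := Rᵀ) ((Matrix.isUnit_transpose _).2 hE)
      (fun μ h3 h1 => hdisj μ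
        (by rwa [← Matrix.transpose_smul, ← Matrix.transpose_sub, Matrix.det_transpose] at h1)
        (by rwa [← Matrix.transpose_smul, ← Matrix.transpose_sub, Matrix.det_transpose] at h3))
      (by rw [← Matrix.transpose_mul, ← Matrix.transpose_mul, hA])
      (by rw [← Matrix.transpose_mul, ← Matrix.transpose_mul, hER])
    simpa [and_comm] using h

/-- The linear map `(R, L) ↦ (A₁R - LA₃, E₁R - LE₃)` underlying the generalized Sylvester
equations. -/
def generalizedSylvesterMap {K : Type*} [Field K] (E1 A1 : Matrix ι ι K) (E3 A3 : Matrix κ κ K) :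
    Matrix ι κ K × Matrix ι κ K →ₗ[K] Matrix ι κ K × Matrix ι κ K where
  toFun X := (A1 * X.1 - X.2 * A3, E1 * X.1 - X.2 * E3)
  map_add' X Y := by
    ext1 <;> simp only [Prod.fst_add, Prod.snd_add, Matrix.mul_add, Matrix.add_mul] <;> abel
  map_smul' c X := by simp [smul_sub]

theorem cplx_mul {m n p : Type*} [Fintype n] (X : Matrix m n ℝ) (Y : Matrix n p ℝ) :
    cplx (X * Y) = cplx X * cplx Y :=
  Matrix.map_mul (f := Complex.ofRealHom)

/-- The real generalized Sylvester equations are solvable for every right-hand side if the pairs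
have no common complex eigenvalue and one of the leading matrices is invertible. -/
theorem generalizedSylvesterMap_surjective {E1 A1 : Matrix ι ι ℝ} {E3 A3 : Matrix κ κ ℝ}
    (hE : IsUnit E1 ∨ IsUnit E3)
    (hdisj : ∀ μ : ℂ, (μ • cplx E1 - cplx A1).det = 0 → (μ • cplx E3 - cplx A3).det ≠ 0) :
    Function.Surjective (generalizedSylvesterMap E1 A1 E3 A3) := by
  have cplx_eq_zero (X : Matrix ι κ ℝ) (hX : cplx X = 0) : X = 0 := by
    ext i j
    simpa [cplx] using congrFun (congrFun hX i) j
  refine LinearMap.injective_iff_surjective.1 ((injective_iff_map_eq_zero _).2 ?_)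
  rintro ⟨R, L⟩ h
  obtain ⟨hA, hER⟩ := Prod.ext_iff.1 h
  have hEC : IsUnit (cplx E1) ∨ IsUnit (cplx E3) :=
    hE.imp (fun h => h.map Complex.ofRealHom.mapMatrix) (fun h => h.map Complex.ofRealHom.mapMatrix)
  obtain ⟨hR, hL⟩ := generalizedSylvester_homogeneous (R := cplx R) (L := cplx L) hEC hdisj
    (by rw [← cplx_mul, ← cplx_mul, sub_eq_zero.1 hA])
    (by rw [← cplx_mul, ← cplx_mul, sub_eq_zero.1 hER])
  rw [cplx_eq_zero R hR, cplx_eq_zero L hL, Prod.mk_zero_zero]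

/-- A solution of a generalized Sylvester equation block-diagonalizes a block triangular matrix. -/
theorem fromBlocks_mul_mul_eq_diagonal {K : Type*} [Field K] {X : Matrix ι ι K}
    {Y R L : Matrix ι κ K} {Z : Matrix κ κ K} (h : X * R - L * Z = -Y) :
    Matrix.fromBlocks 1 (-L) 0 1 * Matrix.fromBlocks X Y 0 Z * Matrix.fromBlocks 1 R 0 1 =
      Matrix.fromBlocks X 0 0 Z := by
  have h' : X * R + (Y + -(L * Z)) = 0 := by
    rw [add_comm Y, ← add_assoc, ← sub_eq_add_neg, h, neg_add_cancel]
  simp [Matrix.fromBlocks_multiply, h']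

end GeneralizedSylvester

theorem stmt0 {k l : ℕ}
    (E1 A1 : Matrix (Fin k) (Fin k) ℝ) (E3 A3 : Matrix (Fin l) (Fin l) ℝ)
    (h1 : RegularPair E1 A1) (h3 : RegularPair E3 A3)
    (hdisj : {lam : ℂ | (lam • cplx E1 - cplx A1).det = 0} ∩
        {lam : ℂ | (lam • cplx E3 - cplx A3).det = 0} = ∅)
    (hE : IsUnit E1 ∨ IsUnit E3)
    (E2 A2 : Matrix (Fin k) (Fin l) ℝ) :
    ∃ R L : Matrix (Fin k) (Fin l) ℝ,
      A1 * R - L * A3 = -A2 ∧ E1 * R - L * E3 = -E2 ∧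
      Matrix.fromBlocks 1 (-L) 0 1 * Matrix.fromBlocks E1 E2 0 E3 *
          Matrix.fromBlocks 1 R 0 1 = Matrix.fromBlocks E1 0 0 E3 ∧
      Matrix.fromBlocks 1 (-L) 0 1 * Matrix.fromBlocks A1 A2 0 A3 *
          Matrix.fromBlocks 1 R 0 1 = Matrix.fromBlocks A1 0 0 A3 := by
  obtain ⟨⟨R, L⟩, hRL⟩ := generalizedSylvesterMap_surjective hE
    (fun μ hμ1 hμ3 => (Set.ext_iff.1 hdisj μ).1 ⟨hμ1, hμ3⟩) (-A2, -E2)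
  obtain ⟨hA, hER⟩ := Prod.ext_iff.1 hRL
  exact ⟨R, L, hA, hER, fromBlocks_mul_mul_eq_diagonal hER, fromBlocks_mul_mul_eq_diagonal hA⟩

end
end

section
/- For every stable system Ŝ (of any order n̂, with m inputs and p outputs), the extended-real-valued Lebesgue integrals satisfy ∫_ℝ ‖G(iω) − G_{Ŝ}(iω)‖_F² dω ≥ ∫_ℝ ‖G_{S₋}(iω)‖_F² dω, and for Ŝ = S₊ equality holds: ∫_ℝ ‖G(iω) − G_{S₊}(iω)‖_F² dω = ∫_ℝ ‖G_{S₋}(iω)‖_F² dω. Hence S₊ is an optimal RH₂-approximation: the infimum of ∫_ℝ ‖G(iω) − G_{Ŝ}(iω)‖_F² dω over all stable systems Ŝ equals ∫_ℝ ‖G_{S₋}(iω)‖_F² dω and is attained at S₊. -/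
open Matrix

noncomputable section

open Filter Asymptotics Bornology MeasureTheory Polynomial Topology

lemma iax_re (ω : ℝ) : (iax ω).re = 0 := by simp [iax]

lemma norm_iax (ω : ℝ) : ‖iax ω‖ = ‖ω‖ := by simp [iax]

lemma continuous_iax : Continuous iax := by unfold iax; fun_prop

lemma conj_iax (ω : ℝ) : star (iax ω) = -iax ω := by simp [iax]

lemma tendsto_iax_cobounded : Tendsto iax (cobounded ℝ) (cobounded ℂ) := by
  rw [← tendsto_norm_atTop_iff_cobounded]
  simpa only [norm_iax] using tendsto_norm_cobounded_atTop (E := ℝ)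

/-- A continuous function on the line that decays quadratically is integrable. -/
lemma integrable_of_sq_mul_isBigO_one {F : Type*} [NormedAddCommGroup F] {ψ : ℝ → F}
    (hψ : Continuous ψ)
    (hO : (fun ω => ‖ω‖ ^ 2 * ‖ψ ω‖) =O[cobounded ℝ] fun _ => (1 : ℝ)) : Integrable ψ := by
  refine hψ.locallyIntegrable.integrable_of_isBigO_cocompact (g := fun x : ℝ => (1 + x ^ 2)⁻¹) ?_
    (integrable_inv_one_add_sq.integrableAtFilter _)
  rw [← Metric.cobounded_eq_cocompact]
  obtain ⟨c, hc⟩ := hO.bound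
  refine IsBigO.of_bound (2 * c) ?_
  filter_upwards [hc, tendsto_norm_cobounded_atTop.eventually_ge_atTop (1 : ℝ)] with x hx h1
  have h2 : (1 : ℝ) ≤ x ^ 2 := by
    rw [← sq_abs, ← Real.norm_eq_abs]; nlinarith
  have hp : (0 : ℝ) < 1 + x ^ 2 := by positivity
  rw [Real.norm_of_nonneg (inv_nonneg.2 hp.le), ← div_eq_mul_inv, le_div_iff₀ hp]
  rw [Real.norm_of_nonneg (by positivity), Real.norm_eq_abs, sq_abs] at hx
  simp only [norm_one, mul_one] at hx
  nlinarith [norm_nonneg (ψ x)]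

/-- The Cauchy theorem for the right half-plane: a function holomorphic on `0 ≤ Re s` with quadratic
decay has vanishing integral along the imaginary axis. -/
lemma integral_iax_eq_zero {g : ℂ → ℂ} (hg : DifferentiableOn ℂ g {s | 0 ≤ s.re})
    (hO : (fun s => s ^ 2 * g s) =O[cobounded ℂ] fun _ => (1 : ℝ)) :
    Integrable (fun ω => g (iax ω)) ∧ ∫ ω, g (iax ω) = 0 := by
  have hcont : Continuous fun ω => g (iax ω) :=
    hg.continuousOn.comp_continuous continuous_iax fun ω => (iax_re ω).ge
  have hint : Integrable fun ω => g (iax ω) := by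
    refine integrable_of_sq_mul_isBigO_one hcont ?_
    refine ((hO.comp_tendsto tendsto_iax_cobounded).norm_left).congr_left fun ω => ?_
    simp [norm_iax]
  refine ⟨hint, ?_⟩
  have hlim := intervalIntegral_tendsto_integral hint tendsto_neg_atTop_atBot tendsto_id
  refine tendsto_nhds_unique hlim ?_
  obtain ⟨c, hc⟩ := hO.bound
  obtain ⟨R₀, -, hR₀⟩ := (hasBasis_cobounded_norm (E := ℂ)).eventually_iff.1 hc
  have hbd : ∀ R : ℝ, 0 < R → R₀ ≤ R → ∀ s : ℂ, R ≤ ‖s‖ → ‖g s‖ ≤ c / R ^ 2 := by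
    intro R hR hRR s hs
    have h1 := hR₀ (x := s) (hRR.trans hs)
    rw [norm_mul, norm_pow, norm_one, mul_one] at h1
    rw [le_div_iff₀ (by positivity)]
    calc ‖g s‖ * R ^ 2 ≤ ‖g s‖ * ‖s‖ ^ 2 := by gcongr
      _ ≤ c := by linarith
  have hz : Tendsto (fun R : ℝ => 4 * c / R) atTop (𝓝 0) := tendsto_id.const_div_atTop _
  refine squeeze_zero_norm' ?_ hz
  filter_upwards [eventually_ge_atTop R₀, eventually_gt_atTop 0] with R hRR hR
  have hb := hbd R hR hRR
  have key := Complex.integral_boundary_rect_eq_zero_of_differentiableOn g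
    (⟨0, -R⟩ : ℂ) (⟨R, R⟩ : ℂ) (hg.mono ?_)
  · have h1 : ‖∫ x : ℝ in (0 : ℝ)..R, g (x + (-R : ℝ) * Complex.I)‖ ≤ c / R ^ 2 * |R - 0| := by
      refine intervalIntegral.norm_integral_le_of_norm_le_const fun x _ => hb _ ?_
      refine le_trans ?_ (Complex.abs_im_le_norm _)
      simp [abs_of_pos hR]
    have h2 : ‖∫ x : ℝ in (0 : ℝ)..R, g (x + R * Complex.I)‖ ≤ c / R ^ 2 * |R - 0| := by
      refine intervalIntegral.norm_integral_le_of_norm_le_const fun x _ => hb _ ?_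
      refine le_trans ?_ (Complex.abs_im_le_norm _)
      simp [abs_of_pos hR]
    have h3 : ‖∫ y : ℝ in (-R)..R, g (R + y * Complex.I)‖ ≤ c / R ^ 2 * |R - -R| := by
      refine intervalIntegral.norm_integral_le_of_norm_le_const fun x _ => hb _ ?_
      refine le_trans ?_ (Complex.abs_re_le_norm _)
      simp [abs_of_pos hR]
    simp only [smul_eq_mul, Complex.ofReal_zero, zero_add] at key
    have e : Complex.I * (∫ y : ℝ in (-R)..R, g (iax y)) =
        (∫ x : ℝ in (0 : ℝ)..R, g (x + (-R : ℝ) * Complex.I)) -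
        (∫ x : ℝ in (0 : ℝ)..R, g (x + R * Complex.I)) +
        Complex.I * ∫ y : ℝ in (-R)..R, g (R + y * Complex.I) := by
      simp only [iax]
      linear_combination -key
    have e2 := congrArg norm e
    rw [norm_mul, Complex.norm_I, one_mul] at e2
    simp only [id]
    rw [e2]
    refine (norm_add_le _ _).trans ?_
    rw [norm_mul, Complex.norm_I, one_mul]
    have e3 : 4 * c / R = c / R ^ 2 * |R - 0| + c / R ^ 2 * |R - 0| + c / R ^ 2 * |R - -R| := by
      rw [sub_zero, abs_of_pos hR, abs_of_pos (by linarith : 0 < R - -R)]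
      field_simp
      ring
    rw [e3]
    exact add_le_add ((norm_sub_le _ _).trans (add_le_add h1 h2)) h3
  · intro s hs
    have := (Complex.mem_reProdIm.1 hs).1
    rw [Set.uIcc_of_le hR.le] at this
    exact this.1

/-- A rational function which is square-integrable along the imaginary axis is strictly proper. -/
lemma mul_div_isBigO_one_of_integrable {P Q : ℂ[X]}
    (hint : Integrable fun ω : ℝ => ‖P.eval (iax ω) / Q.eval (iax ω)‖ ^ 2) (hQ0 : Q ≠ 0) :
    (fun s => s * (P.eval s / Q.eval s)) =O[cobounded ℂ] fun _ => (1 : ℝ) := by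
  have hQ : ∀ᶠ s in cobounded ℂ, Q.eval s ≠ 0 := by
    rw [Metric.cobounded_eq_cocompact]
    exact cocompact_le_cofinite (eventually_cofinite_not_isRoot hQ0)
  by_cases hdeg : (X * P).degree ≤ Q.degree
  · obtain ⟨c, hc⟩ := (isBigO_cobounded_of_degree_le hdeg).bound
    refine IsBigO.of_bound c ?_
    filter_upwards [hc, hQ] with s hs hQs
    rw [← mul_div_assoc, norm_div, div_le_iff₀ (norm_pos_iff.2 hQs)]
    simpa using hs
  · exfalso
    have hle : Q.degree ≤ P.degree := by
      by_cases hP : P = 0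
      · simp [hP] at hdeg
      rw [mul_comm, degree_mul_X, not_le, degree_eq_natDegree hP, degree_eq_natDegree hQ0] at hdeg
      rw [degree_eq_natDegree hP, degree_eq_natDegree hQ0]
      norm_cast at hdeg ⊢
      omega
    obtain ⟨c, hc0, hc⟩ := (isBigO_cobounded_of_degree_le hle).exists_pos
    have hev : ∀ᶠ ω in cobounded ℝ,
        (c⁻¹) ^ 2 ≤ ‖P.eval (iax ω) / Q.eval (iax ω)‖ ^ 2 := by
      refine tendsto_iax_cobounded.eventually (p := fun s =>
        (c⁻¹) ^ 2 ≤ ‖P.eval s / Q.eval s‖ ^ 2) ?_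
      filter_upwards [hc.bound, hQ] with s hs hQs
      have := norm_pos_iff.2 hQs
      gcongr
      rw [norm_div, le_div_iff₀ this, inv_mul_le_iff₀ hc0]
      exact hs
    obtain ⟨R, -, hR⟩ := (hasBasis_cobounded_norm (E := ℝ)).eventually_iff.1 hev
    have hI : IntegrableOn (fun _ : ℝ => (c⁻¹) ^ 2) (Set.Ioi R) := by
      refine Integrable.mono' hint.integrableOn aestronglyMeasurable_const ?_
      refine (ae_restrict_iff' measurableSet_Ioi).2 (ae_of_all _ fun x hx => ?_)
      rw [Real.norm_of_nonneg (by positivity)]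
      exact hR (x := x) ((le_of_lt hx).trans (le_abs_self x))
    rw [integrableOn_const_iff] at hI
    rcases hI with hI | hI
    · simp [hc0.ne'] at hI
    · simp at hI

/-- Orthogonality of the two Hardy spaces for a rational function `P / Q` without poles in the
closed right half-plane and a strictly proper `h` whose reflection `k` has none either. -/
lemma lintegral_norm_sq_le_of_rational {P Q : ℂ[X]} (hQ : ∀ s : ℂ, 0 ≤ s.re → Q.eval s ≠ 0)
    {h : ℝ → ℂ} {k : ℂ → ℂ} (hk : DifferentiableOn ℂ k {s | 0 ≤ s.re})
    (hkO : (fun s => s * k s) =O[cobounded ℂ] fun _ => (1 : ℝ))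
    (hkh : ∀ ω, k (iax ω) = star (h ω)) :
    ∫⁻ ω, ENNReal.ofReal (‖h ω‖ ^ 2) ≤
      ∫⁻ ω, ENNReal.ofReal (‖P.eval (iax ω) / Q.eval (iax ω) + h ω‖ ^ 2) := by
  set f : ℂ → ℂ := fun s => P.eval s / Q.eval s with hf
  have hfd : DifferentiableOn ℂ f {s | 0 ≤ s.re} :=
    P.differentiable.differentiableOn.div Q.differentiable.differentiableOn hQ
  have hfc : Continuous fun ω => f (iax ω) :=
    hfd.continuousOn.comp_continuous continuous_iax fun ω => (iax_re ω).ge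
  have hhc : Continuous h := by
    have h1 : Continuous fun ω => star (k (iax ω)) :=
      (hk.continuousOn.comp_continuous continuous_iax fun ω => (iax_re ω).ge).star
    exact h1.congr fun ω => by rw [hkh, star_star]
  have hsum : Continuous fun ω => ‖f (iax ω) + h ω‖ ^ 2 := (hfc.add hhc).norm.pow 2
  by_cases htop : ∫⁻ ω, ENNReal.ofReal (‖f (iax ω) + h ω‖ ^ 2) = ⊤
  · exact htop ▸ le_top
  have hsumI : Integrable fun ω => ‖f (iax ω) + h ω‖ ^ 2 :=
    (lintegral_ofReal_ne_top_iff_integrable hsum.aestronglyMeasurable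
      (ae_of_all _ fun ω => by positivity)).1 htop
  have hhI : Integrable fun ω => ‖h ω‖ ^ 2 := by
    refine integrable_of_sq_mul_isBigO_one (by fun_prop) ?_
    have h1 := (hkO.comp_tendsto tendsto_iax_cobounded).norm_left
    refine ((h1.mul h1).congr_left fun ω => ?_).congr_right fun ω => by simp
    simp [norm_iax, hkh, mul_pow, ← pow_two]
  have hfI : Integrable fun ω => ‖f (iax ω)‖ ^ 2 := by
    refine ((hsumI.const_mul 2).add (hhI.const_mul 2)).mono'
      (hfc.norm.pow 2).aestronglyMeasurable (ae_of_all _ fun ω => ?_)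
    rw [Real.norm_of_nonneg (by positivity)]
    have h1 : ‖f (iax ω)‖ ≤ ‖f (iax ω) + h ω‖ + ‖h ω‖ := by
      simpa using norm_sub_le (f (iax ω) + h ω) (h ω)
    simp only [Pi.add_apply]
    nlinarith [norm_nonneg (f (iax ω)), sq_nonneg (‖f (iax ω) + h ω‖ - ‖h ω‖)]
  have hQ0 : Q ≠ 0 := fun h0 => hQ 0 le_rfl (by simp [h0])
  have hfO := mul_div_isBigO_one_of_integrable hfI hQ0
  obtain ⟨hcrossI, hcross⟩ := integral_iax_eq_zero (hfd.mul hk)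
    (((hfO.mul hkO).congr_left fun s => by simp only [hf, Pi.mul_apply]; ring).congr_right
      fun s => by simp)
  have hre : ∫ ω, (f (iax ω) * k (iax ω)).re = 0 := by
    have := integral_re (𝕜 := ℂ) hcrossI
    simp only [Pi.mul_apply] at this hcross
    rw [hcross] at this
    simpa using this
  have hreI : Integrable fun ω => (f (iax ω) * k (iax ω)).re := hcrossI.re
  rw [← ofReal_integral_eq_lintegral_ofReal hhI (ae_of_all _ fun ω => by positivity),
    ← ofReal_integral_eq_lintegral_ofReal hsumI (ae_of_all _ fun ω => by positivity)]
  refine ENNReal.ofReal_le_ofReal ?_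
  calc ∫ ω, ‖h ω‖ ^ 2 = ∫ ω, (‖h ω‖ ^ 2 + 2 * (f (iax ω) * k (iax ω)).re) := by
        rw [integral_add hhI (hreI.const_mul 2), integral_const_mul, hre, mul_zero, add_zero]
    _ ≤ ∫ ω, ‖f (iax ω) + h ω‖ ^ 2 := by
        refine integral_mono (hhI.add (hreI.const_mul 2)) hsumI fun ω => ?_
        simp only [hkh, ← Complex.normSq_eq_norm_sq, Complex.normSq_add, Complex.star_def]
        linarith [Complex.normSq_nonneg (f (iax ω))]

/-- Entries of a transfer function are rational, with denominator `det (sE - A)`. -/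
lemma exists_transfer_apply_eq_div {ι κm κp : Type*} [Fintype ι] [DecidableEq ι]
    (E A : Matrix ι ι ℝ) (B : Matrix ι κm ℝ) (C : Matrix κp ι ℝ) (D : Matrix κp κm ℝ)
    (i : κp) (j : κm) :
    ∃ P Q : ℂ[X], (∀ s, Q.eval s = (s • cplx E - cplx A).det) ∧
      ∀ s, IsUnit (s • cplx E - cplx A) → transfer E A B C D s i j = P.eval s / Q.eval s := by
  set M : Matrix ι ι ℂ[X] :=
    (X : ℂ[X]) • (cplx E).map Polynomial.C - (cplx A).map Polynomial.C with hM
  have hMs : ∀ s : ℂ, (evalRingHom s).mapMatrix M = s • cplx E - cplx A := by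
    intro s
    ext a b
    simp [hM, mul_comm s]
  have hdet : ∀ s, M.det.eval s = (s • cplx E - cplx A).det := by
    intro s
    rw [← hMs, ← RingHom.map_det, coe_evalRingHom]
  refine ⟨((cplx C).map Polynomial.C * M.adjugate * (cplx B).map Polynomial.C) i j +
    Polynomial.C (cplx D i j) * M.det, M.det, hdet, fun s hs => ?_⟩
  have hne : M.det.eval s ≠ 0 := by
    rw [hdet]
    exact ((Matrix.isUnit_iff_isUnit_det _).1 hs).ne_zero
  have hadj : ∀ a b, (M.adjugate a b).eval s = (s • cplx E - cplx A).adjugate a b := by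
    intro a b
    rw [← hMs, ← RingHom.map_adjugate]
    rfl
  rw [eval_add, eval_mul, eval_C, add_div, mul_div_cancel_right₀ _ hne]
  simp only [transfer, Matrix.add_apply, Matrix.inv_def, Ring.inverse_eq_inv', Matrix.mul_smul,
    Matrix.smul_mul, Matrix.smul_apply, smul_eq_mul, ← hdet]
  rw [inv_mul_eq_div]
  simp [Matrix.mul_apply, eval_finsetSum, hadj]

lemma transfer_star {ι κm κp : Type*} [Fintype ι] [DecidableEq ι]
    (E A : Matrix ι ι ℝ) (B : Matrix ι κm ℝ) (C : Matrix κp ι ℝ) (D : Matrix κp κm ℝ) (s : ℂ) :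
    transfer E A B C D (star s) = (transfer E A B C D s).map star := by
  have hinv : (star s • cplx E - cplx A)⁻¹ = (s • cplx E - cplx A)⁻¹.map star := by
    have h1 : star s • cplx E - cplx A = (s • cplx E - cplx A)ᴴᵀ := by
      ext a b
      simp [cplx]
    rw [h1, ← Matrix.transpose_nonsing_inv, ← Matrix.conjTranspose_nonsing_inv]
    rfl
  ext a b
  simp only [transfer, hinv, Matrix.mul_apply, Matrix.add_apply, Matrix.map_apply]
  simp [cplx]

/-- A system with invertible `E` and no feedthrough is strictly proper. -/
lemma mul_transfer_isBigO_one {ι κm κp : Type*} [Fintype ι] [DecidableEq ι]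
    {E : Matrix ι ι ℝ} (hE : IsUnit E) (A : Matrix ι ι ℝ) (B : Matrix ι κm ℝ)
    (C : Matrix κp ι ℝ) (i : κp) (j : κm) :
    (fun s => s * transfer E A B C 0 s i j) =O[cobounded ℂ] fun _ => (1 : ℝ) := by
  have hdet : (cplx E).det ≠ 0 := by
    have h1 : (cplx E).det = ((E.det : ℝ) : ℂ) := (RingHom.map_det Complex.ofRealHom E).symm
    rw [h1]
    exact_mod_cast ((Matrix.isUnit_iff_isUnit_det _).1 hE).ne_zero
  have h0 : Tendsto (fun s : ℂ => cplx E - s⁻¹ • cplx A) (cobounded ℂ) (𝓝 (cplx E)) := by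
    have := (tendsto_inv₀_cobounded (α := ℂ)).smul_const (cplx A)
    simpa using this.const_sub (cplx E)
  have hlim : Tendsto (fun s : ℂ => (cplx C * (cplx E - s⁻¹ • cplx A)⁻¹ * cplx B) i j)
      (cobounded ℂ) (𝓝 ((cplx C * (cplx E)⁻¹ * cplx B) i j)) := by
    have h1 : Tendsto (fun s : ℂ => (cplx E - s⁻¹ • cplx A)⁻¹) (cobounded ℂ)
        (𝓝 (cplx E)⁻¹) := by
      refine (continuousAt_matrix_inv (cplx E) ?_).tendsto.comp h0
      rw [Ring.inverse_eq_inv']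
      exact continuousAt_inv₀ hdet
    have hcont : Continuous fun N : Matrix ι ι ℂ => (cplx C * N * cplx B) i j := by fun_prop
    exact (hcont.tendsto _).comp h1
  refine (hlim.isBigO_one ℝ).congr' ?_ EventuallyEq.rfl
  have hdet' : ∀ᶠ s in cobounded ℂ, (cplx E - s⁻¹ • cplx A).det ≠ 0 :=
    ((continuous_id.matrix_det.tendsto _).comp h0).eventually_ne hdet
  filter_upwards [eventually_ne_cobounded 0, hdet'] with s hs hds
  have h2 : s • cplx E - cplx A = s • (cplx E - s⁻¹ • cplx A) := by
    rw [smul_sub, smul_smul, mul_inv_cancel₀ hs, one_smul]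
  have h3 : (s • (cplx E - s⁻¹ • cplx A))⁻¹ = s⁻¹ • (cplx E - s⁻¹ • cplx A)⁻¹ :=
    Matrix.inv_smul' _ (Units.mk0 s hs) hds.isUnit
  have h4 : cplx (0 : Matrix κp κm ℝ) = 0 := by ext; simp [cplx]
  rw [transfer, h2, h3, h4, add_zero, Matrix.mul_smul, Matrix.smul_mul, Matrix.smul_apply,
    smul_eq_mul, mul_inv_cancel_left₀ hs]

/-- The distance from an antistable strictly proper transfer function to the difference of two
stable ones is minimal for the zero difference. -/
lemma lintegral_frobSq_antistable_le {np nm n' m p : ℕ}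
    (Ep Ap : Matrix (Fin np) (Fin np) ℝ) (Bp : Matrix (Fin np) (Fin m) ℝ)
    (Cp : Matrix (Fin p) (Fin np) ℝ) (D : Matrix (Fin p) (Fin m) ℝ)
    (Em Am : Matrix (Fin nm) (Fin nm) ℝ) (Bm : Matrix (Fin nm) (Fin m) ℝ)
    (Cm : Matrix (Fin p) (Fin nm) ℝ)
    (E' A' : Matrix (Fin n') (Fin n') ℝ) (B' : Matrix (Fin n') (Fin m) ℝ)
    (C' : Matrix (Fin p) (Fin n') ℝ) (D' : Matrix (Fin p) (Fin m) ℝ)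
    (hp : StablePair Ep Ap) (hm : AntistablePair Em Am) (h' : StablePair E' A') :
    ∫⁻ ω : ℝ, ENNReal.ofReal (frobSq (transfer Em Am Bm Cm 0 (iax ω))) ≤
      ∫⁻ ω : ℝ, ENNReal.ofReal (frobSq
        (transfer Ep Ap Bp Cp D (iax ω) + transfer Em Am Bm Cm 0 (iax ω) -
          transfer E' A' B' C' D' (iax ω))) := by
  have hmeas : ∀ {n : ℕ} (E A : Matrix (Fin n) (Fin n) ℝ) (B : Matrix (Fin n) (Fin m) ℝ)
      (C : Matrix (Fin p) (Fin n) ℝ) (D : Matrix (Fin p) (Fin m) ℝ)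
      (_ : ∀ ω, IsUnit (iax ω • cplx E - cplx A)) (i : Fin p) (j : Fin m),
      Measurable fun ω => transfer E A B C D (iax ω) i j := by
    intro n E A B C D hu i j
    obtain ⟨P, Q, -, hPQ⟩ := exists_transfer_apply_eq_div E A B C D i j
    simp only [hPQ _ (hu _)]
    exact (P.continuous.measurable.comp continuous_iax.measurable).div
      (Q.continuous.measurable.comp continuous_iax.measurable)
  have hmp := hmeas Ep Ap Bp Cp D fun ω => hp _ (iax_re ω).ge
  have hmm := hmeas Em Am Bm Cm 0 fun ω => hm.2 _ (iax_re ω).le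
  have hm' := hmeas E' A' B' C' D' fun ω => h' _ (iax_re ω).ge
  have expand : ∀ F : ℝ → Matrix (Fin p) (Fin m) ℂ, (∀ i j, Measurable fun ω => F ω i j) →
      ∫⁻ ω, ENNReal.ofReal (frobSq (F ω)) =
        ∑ i, ∑ j, ∫⁻ ω, ENNReal.ofReal (‖F ω i j‖ ^ 2) := by
    intro F hF
    have hF' : ∀ i j, Measurable fun ω => ENNReal.ofReal (‖F ω i j‖ ^ 2) := fun i j =>
      ((hF i j).norm.pow_const 2).ennreal_ofReal
    have e : ∀ ω, ENNReal.ofReal (frobSq (F ω)) =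
        ∑ i, ∑ j, ENNReal.ofReal (‖F ω i j‖ ^ 2) := by
      intro ω
      rw [frobSq, ENNReal.ofReal_sum_of_nonneg fun i _ => by positivity]
      exact Finset.sum_congr rfl fun i _ => ENNReal.ofReal_sum_of_nonneg fun j _ => by positivity
    simp only [e]
    rw [lintegral_finsetSum _ fun i _ => Finset.measurable_sum _ fun j _ => hF' i j]
    exact Finset.sum_congr rfl fun i _ => lintegral_finsetSum _ fun j _ => hF' i j
  rw [expand _ hmm, expand (fun ω => transfer Ep Ap Bp Cp D (iax ω) +
    transfer Em Am Bm Cm 0 (iax ω) - transfer E' A' B' C' D' (iax ω))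
    fun i j => ((hmp i j).add (hmm i j)).sub (hm' i j)]
  refine Finset.sum_le_sum fun i _ => Finset.sum_le_sum fun j _ => ?_
  obtain ⟨P₁, Q₁, hQ₁, hPQ₁⟩ := exists_transfer_apply_eq_div Ep Ap Bp Cp D i j
  obtain ⟨P₂, Q₂, hQ₂, hPQ₂⟩ := exists_transfer_apply_eq_div E' A' B' C' D' i j
  obtain ⟨P₃, Q₃, hQ₃, hPQ₃⟩ := exists_transfer_apply_eq_div Em Am Bm Cm 0 i j
  have h₁ : ∀ s : ℂ, 0 ≤ s.re → Q₁.eval s ≠ 0 := fun s hs => by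
    rw [hQ₁]; exact ((Matrix.isUnit_iff_isUnit_det _).1 (hp s hs)).ne_zero
  have h₂ : ∀ s : ℂ, 0 ≤ s.re → Q₂.eval s ≠ 0 := fun s hs => by
    rw [hQ₂]; exact ((Matrix.isUnit_iff_isUnit_det _).1 (h' s hs)).ne_zero
  have h₃ : ∀ s : ℂ, 0 ≤ s.re → Q₃.eval (-s) ≠ 0 := fun s hs => by
    rw [hQ₃]; exact ((Matrix.isUnit_iff_isUnit_det _).1 (hm.2 (-s) (by simpa using hs))).ne_zero
  have key := lintegral_norm_sq_le_of_rational (P := P₁ * Q₂ - Q₁ * P₂) (Q := Q₁ * Q₂)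
    (h := fun ω => transfer Em Am Bm Cm 0 (iax ω) i j)
    (k := fun s => transfer Em Am Bm Cm 0 (-s) i j)
    (fun s hs => by rw [eval_mul]; exact mul_ne_zero (h₁ s hs) (h₂ s hs)) ?_ ?_ ?_
  · refine key.trans_eq (lintegral_congr fun ω => ?_)
    have hω := (iax_re ω).ge
    rw [Matrix.sub_apply, Matrix.add_apply, hPQ₁ _ (hp _ hω), hPQ₂ _ (h' _ hω), eval_sub, eval_mul,
      eval_mul, eval_mul, ← div_sub_div _ _ (h₁ _ hω) (h₂ _ hω)]
    congr 3
    ring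
  · have h4 : DifferentiableOn ℂ (fun s : ℂ => P₃.eval (-s) / Q₃.eval (-s)) {s | 0 ≤ s.re} :=
      (P₃.differentiable.comp differentiable_neg).differentiableOn.div
        (Q₃.differentiable.comp differentiable_neg).differentiableOn h₃
    exact h4.congr fun s hs => hPQ₃ _ (hm.2 _ (by simpa using hs))
  · refine ((mul_transfer_isBigO_one hm.1 Am Bm Cm i j).comp_tendsto
      tendsto_neg_cobounded).neg_left.congr_left fun s => ?_
    simp
  · intro ω
    simp only [← conj_iax, transfer_star, Matrix.map_apply]

open scoped ENNReal in
theorem stmt6 {np nm m p : ℕ}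
    (Ep Ap : Matrix (Fin np) (Fin np) ℝ) (Bp : Matrix (Fin np) (Fin m) ℝ)
    (Cp : Matrix (Fin p) (Fin np) ℝ) (D : Matrix (Fin p) (Fin m) ℝ)
    (Em Am : Matrix (Fin nm) (Fin nm) ℝ) (Bm : Matrix (Fin nm) (Fin m) ℝ)
    (Cm : Matrix (Fin p) (Fin nm) ℝ)
    (hp : StablePair Ep Ap) (hm : AntistablePair Em Am) :
    (∀ (n' : ℕ) (E' A' : Matrix (Fin n') (Fin n') ℝ) (B' : Matrix (Fin n') (Fin m) ℝ)
        (C' : Matrix (Fin p) (Fin n') ℝ) (D' : Matrix (Fin p) (Fin m) ℝ),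
      StablePair E' A' →
        ∫⁻ ω : ℝ, ENNReal.ofReal (frobSq (transfer Em Am Bm Cm 0 (iax ω))) ≤
        ∫⁻ ω : ℝ, ENNReal.ofReal (frobSq
          (transfer Ep Ap Bp Cp D (iax ω) + transfer Em Am Bm Cm 0 (iax ω) -
            transfer E' A' B' C' D' (iax ω)))) ∧
    (∫⁻ ω : ℝ, ENNReal.ofReal (frobSq
      (transfer Ep Ap Bp Cp D (iax ω) + transfer Em Am Bm Cm 0 (iax ω) -
        transfer Ep Ap Bp Cp D (iax ω))) =
      ∫⁻ ω : ℝ, ENNReal.ofReal (frobSq (transfer Em Am Bm Cm 0 (iax ω)))) ∧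
    sInf {v : ℝ≥0∞ |
        ∃ (n' : ℕ) (E' A' : Matrix (Fin n') (Fin n') ℝ) (B' : Matrix (Fin n') (Fin m) ℝ)
          (C' : Matrix (Fin p) (Fin n') ℝ) (D' : Matrix (Fin p) (Fin m) ℝ),
          StablePair E' A' ∧
          v = ∫⁻ ω : ℝ, ENNReal.ofReal (frobSq
            (transfer Ep Ap Bp Cp D (iax ω) + transfer Em Am Bm Cm 0 (iax ω) -
              transfer E' A' B' C' D' (iax ω)))} =
      ∫⁻ ω : ℝ, ENNReal.ofReal (frobSq (transfer Em Am Bm Cm 0 (iax ω))) := by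
  have hle := fun (n' : ℕ) (E' A' : Matrix (Fin n') (Fin n') ℝ) (B' : Matrix (Fin n') (Fin m) ℝ)
      (C' : Matrix (Fin p) (Fin n') ℝ) (D' : Matrix (Fin p) (Fin m) ℝ)
      (h' : StablePair E' A') =>
    lintegral_frobSq_antistable_le Ep Ap Bp Cp D Em Am Bm Cm E' A' B' C' D' hp hm h'
  refine ⟨hle, by simp only [add_sub_cancel_left], le_antisymm ?_ ?_⟩
  · exact sInf_le ⟨np, Ep, Ap, Bp, Cp, D, hp, by simp only [add_sub_cancel_left]⟩
  · refine le_sInf ?_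
    rintro v ⟨n', E', A', B', C', D', h', rfl⟩
    exact hle n' E' A' B' C' D' h'

end
end

section
/- Let S=(I_n,A,B,C,D) be an antistable system of order n with E = I_n that is a minimal realization of its transfer function G, i.e. every system S'=(E',A',B',C',D') of any order n' whose transfer function agrees with G at every s ∈ ℂ at which both are defined satisfies n' ≥ n. Let S̃=(Ẽ,Ã,B̃,C̃,D̃) be an antistable system of order ñ whose transfer function also agrees with G at every point where both are defined. Let X_c, X_o be Gramians of S and X̃_c, X̃_o Gramians of S̃. Then the nonzero complex spectra agree: spec(X_c X_o) \ {0} = spec(X̃_c Ẽᵀ X̃_o Ẽ) \ {0}, where spec denotes the set of complex eigenvalues. -/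
open Matrix

noncomputable section

open Polynomial in
/-- If `M * K ^ j` annihilates `K * P + P * L` for every `j`, and the spectra of `K` and `-L` are
disjoint in the sense that `K.charpoly` evaluated at `-L` is invertible, then `M * P = 0`. -/
theorem mul_eq_zero_of_mul_pow_mul_sylvester_eq_zero {R a ι κ : Type*} [CommRing R]
    [Fintype ι] [DecidableEq ι] [Fintype κ] [DecidableEq κ]
    {M : Matrix a ι R} {K : Matrix ι ι R} {P : Matrix ι κ R} {L : Matrix κ κ R}
    (hunit : IsUnit (aeval (-L) K.charpoly))
    (h : ∀ j : ℕ, M * K ^ j * (K * P + P * L) = 0) : M * P = 0 := by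
  have hpow : ∀ j : ℕ, M * K ^ j * P = M * P * (-L) ^ j := by
    intro j
    induction j with
    | zero => simp
    | succ j ih =>
      have hj := h j
      rw [Matrix.mul_add, add_eq_zero_iff_eq_neg] at hj
      rw [pow_succ, pow_succ, ← Matrix.mul_assoc, ← Matrix.mul_assoc, ← ih, Matrix.mul_assoc _ K P,
        hj]
      simp [Matrix.mul_assoc]
  have hpoly : ∀ q : R[X], M * aeval K q * P = M * P * aeval (-L) q := by
    intro q
    induction q using Polynomial.induction_on' with
    | add p q hp hq => simp [Matrix.mul_add, Matrix.add_mul, hp, hq]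
    | monomial k r => simp [aeval_monomial, Algebra.algebraMap_eq_smul_one, hpow]
  have h0 := hpoly K.charpoly
  rw [Matrix.aeval_self_charpoly, Matrix.mul_zero, Matrix.zero_mul] at h0
  obtain ⟨u, hu⟩ := hunit
  calc M * P = M * P * ((u : Matrix κ κ R) * ((u⁻¹ : (Matrix κ κ R)ˣ) : Matrix κ κ R)) := by simp
    _ = 0 := by rw [← Matrix.mul_assoc, hu, ← h0, Matrix.zero_mul]

theorem Matrix.smul_one_sub_fromBlocks_diagonal {ι κ R : Type*} [DecidableEq ι] [DecidableEq κ]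
    [Ring R] (s : R) (A : Matrix ι ι R) (B : Matrix κ κ R) :
    s • (1 : Matrix (ι ⊕ κ) (ι ⊕ κ) R) - fromBlocks A 0 0 B =
      fromBlocks (s • 1 - A) 0 0 (s • 1 - B) := by
  rw [← fromBlocks_one, fromBlocks_smul, sub_eq_add_neg, fromBlocks_neg, fromBlocks_add]
  simp [sub_eq_add_neg]

/-- All eigenvalues of the complex matrix `A` have positive real part. -/
def IsAntistable {ι : Type*} [Fintype ι] [DecidableEq ι] (A : Matrix ι ι ℂ) : Prop :=
  ∀ s : ℂ, s.re ≤ 0 → IsUnit (s • (1 : Matrix ι ι ℂ) - A)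

namespace IsAntistable

variable {ι κ : Type*} [Fintype ι] [DecidableEq ι] [Fintype κ] [DecidableEq κ]

theorem transpose {A : Matrix ι ι ℂ} (hA : IsAntistable A) : IsAntistable Aᵀ := by
  intro s hs
  have := (Matrix.isUnit_transpose (A := s • (1 : Matrix ι ι ℂ) - A)).2 (hA s hs)
  simpa using this

theorem fromBlocks_diagonal {A : Matrix ι ι ℂ} {B : Matrix κ κ ℂ} (hA : IsAntistable A)
    (hB : IsAntistable B) : IsAntistable (fromBlocks A 0 0 B) := by
  intro s hs
  rw [smul_one_sub_fromBlocks_diagonal, Matrix.isUnit_iff_isUnit_det, Matrix.det_fromBlocks_zero₁₂]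
  exact ((Matrix.isUnit_iff_isUnit_det _).1 (hA s hs)).mul
    ((Matrix.isUnit_iff_isUnit_det _).1 (hB s hs))

theorem isUnit_aeval_neg_charpoly {K : Matrix ι ι ℂ} {L : Matrix κ κ ℂ} (hK : IsAntistable K)
    (hL : IsAntistable L) : IsUnit (Polynomial.aeval (-L) K.charpoly) := by
  by_contra h
  rw [(IsAlgClosed.splits K.charpoly).eq_prod_roots_of_monic K.charpoly_monic] at h
  obtain ⟨k, hk, hk0⟩ := spectrum.exists_mem_of_not_isUnit_aeval_prod h
  have hre : 0 < k.re := by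
    by_contra! hle
    have hu := (Matrix.isUnit_iff_isUnit_det _).1 (hK k hle)
    rw [Matrix.eval_charpoly, Matrix.scalar_apply, ← Matrix.smul_one_eq_diagonal] at hk0
    exact hu.ne_zero hk0
  refine hk ?_
  have hu := (hL (-k) (by simpa using hre.le)).neg
  rw [spectrum.mem_resolventSet_iff, Algebra.algebraMap_eq_smul_one]
  convert hu using 1
  module

theorem exists_sylvester {K : Matrix ι ι ℂ} {L : Matrix κ κ ℂ} (hK : IsAntistable K)
    (hL : IsAntistable L) (Q : Matrix ι κ ℂ) : ∃ P : Matrix ι κ ℂ, K * P + P * L + Q = 0 := by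
  let f : Matrix ι κ ℂ →ₗ[ℂ] Matrix ι κ ℂ :=
    { toFun := fun P => K * P + P * L
      map_add' := fun X Y => by simp only [Matrix.mul_add, Matrix.add_mul]; abel
      map_smul' := fun c X => by simp }
  have hf : Function.Injective f := by
    rw [← LinearMap.ker_eq_bot, LinearMap.ker_eq_bot']
    intro P hP
    have hP' : K * P + P * L = 0 := hP
    simpa using mul_eq_zero_of_mul_pow_mul_sylvester_eq_zero (M := (1 : Matrix ι ι ℂ))
      (hK.isUnit_aeval_neg_charpoly hL) (fun j => by rw [hP', Matrix.mul_zero])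
  obtain ⟨P, hP⟩ := LinearMap.injective_iff_surjective.1 hf (-Q)
  have hP' : K * P + P * L = -Q := hP
  exact ⟨P, by rw [hP', neg_add_cancel]⟩

open Filter Topology in
theorem tendsto_mul_inv_mul {a b : Type*} (A : Matrix ι ι ℂ) (C : Matrix a ι ℂ)
    (B : Matrix ι b ℂ) :
    Tendsto (fun t : ℝ => C * ((-t : ℂ) • (1 : Matrix ι ι ℂ) - A)⁻¹ * B) atTop (𝓝 0) := by
  let _ : NormedRing (Matrix ι ι ℂ) := Matrix.linftyOpNormedRing
  let _ : NormedAlgebra ℂ (Matrix ι ι ℂ) := Matrix.linftyOpNormedAlgebra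
  have h1 : Tendsto (fun t : ℝ => (-t : ℂ)) atTop (Bornology.cobounded ℂ) := by
    rw [← tendsto_norm_atTop_iff_cobounded]
    simpa using tendsto_abs_atTop_atTop
  have h2 := (spectrum.resolvent_tendsto_cobounded A).comp h1
  have h3 : Tendsto (fun t : ℝ => ((-t : ℂ) • (1 : Matrix ι ι ℂ) - A)⁻¹) atTop (𝓝 0) := by
    refine h2.congr fun t => ?_
    simp [resolvent, Matrix.nonsing_inv_eq_ringInverse, Algebra.algebraMap_eq_smul_one]
  have hc : Continuous fun X : Matrix ι ι ℂ => C * X * B := by fun_prop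
  have h4 := (hc.tendsto 0).comp h3
  rw [Matrix.mul_zero, Matrix.zero_mul] at h4
  exact h4

/-- A transfer function which is constant on the closed left half-plane has vanishing Markov
parameters. -/
theorem mul_pow_mul_eq_zero {a b : Type*} {A : Matrix ι ι ℂ} (hA : IsAntistable A)
    {C : Matrix a ι ℂ} {B : Matrix ι b ℂ} {D : Matrix a b ℂ}
    (h : ∀ s : ℂ, s.re ≤ 0 → C * (s • (1 : Matrix ι ι ℂ) - A)⁻¹ * B = D) (k : ℕ) :
    C * A ^ k * B = 0 := by
  have hconst : ∀ (C' : Matrix a ι ℂ) (D' : Matrix a b ℂ),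
      (∀ s : ℂ, s.re ≤ 0 → C' * (s • (1 : Matrix ι ι ℂ) - A)⁻¹ * B = D') → D' = 0 := by
    intro C' D' h'
    refine tendsto_nhds_unique (Filter.Tendsto.congr' ?_ tendsto_const_nhds)
      (tendsto_mul_inv_mul A C' B)
    filter_upwards [Filter.eventually_ge_atTop 0] with t ht
    exact (h' _ (by simpa using ht)).symm
  have hstep : ∀ (k : ℕ) (s : ℂ), s.re ≤ 0 →
      C * A ^ (k + 1) * (s • (1 : Matrix ι ι ℂ) - A)⁻¹ * B =
        s • (C * A ^ k * (s • (1 : Matrix ι ι ℂ) - A)⁻¹ * B) - C * A ^ k * B := by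
    intro k s hs
    have hu := Matrix.mul_nonsing_inv _ ((Matrix.isUnit_iff_isUnit_det _).1 (hA s hs))
    have hA' : A * (s • (1 : Matrix ι ι ℂ) - A)⁻¹ = s • (s • (1 : Matrix ι ι ℂ) - A)⁻¹ - 1 := by
      rw [Matrix.sub_mul, Matrix.smul_mul, Matrix.one_mul] at hu
      rw [eq_sub_iff_add_eq, ← eq_sub_iff_add_eq', hu]
    rw [pow_succ, ← Matrix.mul_assoc, Matrix.mul_assoc _ A, hA']
    simp [Matrix.mul_sub, Matrix.sub_mul]
  have hzero : ∀ (k : ℕ) (s : ℂ), s.re ≤ 0 →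
      C * A ^ k * (s • (1 : Matrix ι ι ℂ) - A)⁻¹ * B = 0 := by
    intro k
    induction k with
    | zero =>
      intro s hs
      have hD := hconst C D h
      simpa [hD] using h s hs
    | succ k ih =>
      have hs : ∀ s : ℂ, s.re ≤ 0 →
          C * A ^ (k + 1) * (s • (1 : Matrix ι ι ℂ) - A)⁻¹ * B = -(C * A ^ k * B) := by
        intro s hs
        rw [hstep k s hs, ih s hs, smul_zero, zero_sub]
      intro s hs'
      rw [hs s hs', hconst _ _ hs]
  have h0 := hstep k 0 (by simp)
  rw [hzero (k + 1) 0 (by simp), zero_smul, zero_sub] at h0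
  exact neg_eq_zero.1 h0.symm

/-- If the Markov parameters of an antistable system vanish, then so does the product of its
Gramians. -/
theorem gramian_mul_gramian_eq_zero {a b : Type*} [Fintype a] [Fintype b]
    {A : Matrix ι ι ℂ} (hA : IsAntistable A)
    {C : Matrix a ι ℂ} {B : Matrix ι b ℂ} {P Q : Matrix ι ι ℂ}
    (hP : A * P + P * Aᵀ + B * Bᵀ = 0) (hQ : Aᵀ * Q + Q * A + Cᵀ * C = 0)
    (h : ∀ k : ℕ, C * A ^ k * B = 0) : Q * P = 0 := by
  have hCP : ∀ k : ℕ, C * A ^ k * P = 0 := by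
    intro k
    refine mul_eq_zero_of_mul_pow_mul_sylvester_eq_zero (L := Aᵀ)
      (hA.isUnit_aeval_neg_charpoly hA.transpose) fun j => ?_
    rw [add_eq_zero_iff_eq_neg.1 hP, Matrix.mul_assoc C, ← pow_add, Matrix.mul_neg,
      ← Matrix.mul_assoc, h, Matrix.zero_mul, neg_zero]
  have hPQ : Pᵀ * Qᵀ = 0 := by
    refine mul_eq_zero_of_mul_pow_mul_sylvester_eq_zero (L := A)
      (hA.transpose.isUnit_aeval_neg_charpoly hA) fun j => ?_
    have hj : (Aᵀ * Q + Q * A) * A ^ j * P = 0 := by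
      rw [add_eq_zero_iff_eq_neg.1 hQ, Matrix.mul_assoc, Matrix.neg_mul, Matrix.mul_assoc,
        ← Matrix.mul_assoc C, hCP, Matrix.mul_zero, neg_zero]
    have hj' := congrArg Matrix.transpose hj
    simp only [Matrix.transpose_mul, Matrix.transpose_add, Matrix.transpose_pow,
      Matrix.transpose_transpose, Matrix.transpose_zero] at hj'
    rw [Matrix.mul_assoc, add_comm]
    exact hj'
  rw [← Matrix.transpose_mul] at hPQ
  exact Matrix.transpose_eq_zero.1 hPQ

end IsAntistable

theorem Matrix.mem_spectrum_iff_det_eq_zero {ι K : Type*} [Fintype ι] [DecidableEq ι] [Field K]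
    (M : Matrix ι ι K) (z : K) : z ∈ spectrum K M ↔ (z • (1 : Matrix ι ι K) - M).det = 0 := by
  rw [spectrum.mem_iff, Algebra.algebraMap_eq_smul_one, Matrix.isUnit_iff_isUnit_det,
    isUnit_iff_ne_zero, not_not]

theorem Matrix.spectrum_transpose_eq {ι K : Type*} [Fintype ι] [DecidableEq ι] [Field K]
    (M : Matrix ι ι K) : spectrum K Mᵀ = spectrum K M := by
  ext z
  rw [mem_spectrum_iff_det_eq_zero, mem_spectrum_iff_det_eq_zero, ← Matrix.det_transpose]
  simp

theorem Matrix.det_smul_one_sub_mul_eq_zero_iff {ι κ K : Type*} [Fintype ι] [DecidableEq ι]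
    [Fintype κ] [Field K] {z : K} (hz : z ≠ 0) (M : Matrix ι κ K) (N : Matrix κ ι K) :
    (z • (1 : Matrix ι ι K) - M * N).det = 0 ↔ (1 - (z⁻¹ • M) * N).det = 0 := by
  have h : z • (1 : Matrix ι ι K) - M * N = z • (1 - (z⁻¹ • M) * N) := by
    rw [smul_sub, Matrix.smul_mul, smul_smul, mul_inv_cancel₀ hz, one_smul]
  rw [h, Matrix.det_smul, mul_eq_zero, or_iff_right (pow_ne_zero _ hz)]

theorem Matrix.spectrum_mul_comm_diff_zero {ι κ K : Type*} [Fintype ι] [DecidableEq ι]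
    [Fintype κ] [DecidableEq κ] [Field K] (M : Matrix ι κ K) (N : Matrix κ ι K) :
    spectrum K (M * N) \ {0} = spectrum K (N * M) \ {0} := by
  ext z
  simp only [Set.mem_sdiff, Set.mem_singleton_iff]
  refine and_congr_left fun hz => ?_
  rw [mem_spectrum_iff_det_eq_zero, mem_spectrum_iff_det_eq_zero,
    det_smul_one_sub_mul_eq_zero_iff hz, det_smul_one_sub_mul_eq_zero_iff hz,
    Matrix.det_one_sub_mul_comm, Matrix.mul_smul, Matrix.smul_mul]

/-- The nonzero eigenvalues of the product of the Gramians of an antistable system depend only on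
its transfer function. -/
theorem spectrum_gramian_mul_diff_zero_eq {ι κ a b : Type*} [Fintype ι] [DecidableEq ι]
    [Fintype κ] [DecidableEq κ] [Fintype a] [Fintype b]
    {A₁ : Matrix ι ι ℂ} {B₁ : Matrix ι b ℂ} {C₁ : Matrix a ι ℂ}
    {A₂ : Matrix κ κ ℂ} {B₂ : Matrix κ b ℂ} {C₂ : Matrix a κ ℂ} {D₁ D₂ : Matrix a b ℂ}
    (hA₁ : IsAntistable A₁) (hA₂ : IsAntistable A₂)
    (hG : ∀ s : ℂ, s.re ≤ 0 → C₁ * (s • (1 : Matrix ι ι ℂ) - A₁)⁻¹ * B₁ + D₁ =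
      C₂ * (s • (1 : Matrix κ κ ℂ) - A₂)⁻¹ * B₂ + D₂)
    {P₁ Q₁ : Matrix ι ι ℂ} {P₂ Q₂ : Matrix κ κ ℂ}
    (hP₁ : A₁ * P₁ + P₁ * A₁ᵀ + B₁ * B₁ᵀ = 0) (hQ₁ : A₁ᵀ * Q₁ + Q₁ * A₁ + C₁ᵀ * C₁ = 0)
    (hP₂ : A₂ * P₂ + P₂ * A₂ᵀ + B₂ * B₂ᵀ = 0) (hQ₂ : A₂ᵀ * Q₂ + Q₂ * A₂ + C₂ᵀ * C₂ = 0) :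
    spectrum ℂ (P₁ * Q₁) \ {0} = spectrum ℂ (P₂ * Q₂) \ {0} := by
  obtain ⟨P, hP⟩ := hA₁.exists_sylvester hA₂.transpose (B₁ * B₂ᵀ)
  obtain ⟨Q, hQ⟩ := hA₁.transpose.exists_sylvester hA₂ (C₁ᵀ * C₂)
  have hPt : A₂ * Pᵀ + Pᵀ * A₁ᵀ + B₂ * B₁ᵀ = 0 := by
    have := congrArg Matrix.transpose hP
    simp only [Matrix.transpose_add, Matrix.transpose_mul, Matrix.transpose_transpose,
      Matrix.transpose_zero] at this
    rw [← this]
    abel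
  have hQt : A₂ᵀ * Qᵀ + Qᵀ * A₁ + C₂ᵀ * C₁ = 0 := by
    have := congrArg Matrix.transpose hQ
    simp only [Matrix.transpose_add, Matrix.transpose_mul, Matrix.transpose_transpose,
      Matrix.transpose_zero] at this
    rw [← this]
    abel
  have hA := hA₁.fromBlocks_diagonal hA₂
  have hM := hA.mul_pow_mul_eq_zero (C := fromCols C₁ (-C₂)) (B := fromRows B₁ B₂)
    (D := D₂ - D₁) fun s hs => by
      have hinv : (s • (1 : Matrix (ι ⊕ κ) (ι ⊕ κ) ℂ) - fromBlocks A₁ 0 0 A₂)⁻¹ =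
          fromBlocks (s • 1 - A₁)⁻¹ 0 0 (s • 1 - A₂)⁻¹ := by
        refine Matrix.inv_eq_right_inv ?_
        rw [smul_one_sub_fromBlocks_diagonal, fromBlocks_multiply, ← fromBlocks_one]
        simp [Matrix.mul_nonsing_inv _ ((Matrix.isUnit_iff_isUnit_det _).1 (hA₁ s hs)),
          Matrix.mul_nonsing_inv _ ((Matrix.isUnit_iff_isUnit_det _).1 (hA₂ s hs))]
      rw [hinv, Matrix.mul_assoc, fromBlocks_mul_fromRows, fromCols_mul_fromRows]
      simp only [Matrix.zero_mul, add_zero, zero_add, Matrix.neg_mul, ← Matrix.mul_assoc]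
      rw [← sub_eq_add_neg, sub_eq_sub_iff_add_eq_add, hG s hs, add_comm]
  have hQP := hA.gramian_mul_gramian_eq_zero (P := fromBlocks P₁ P Pᵀ P₂)
    (Q := fromBlocks Q₁ (-Q) (-Qᵀ) Q₂)
    (by
      rw [fromBlocks_transpose, fromBlocks_multiply, fromBlocks_multiply, transpose_fromRows,
        fromRows_mul_fromCols, fromBlocks_add, fromBlocks_add, ← fromBlocks_zero]
      simp [hP₁, hP₂, hP, hPt])
    (by
      have h12 : -(A₁ᵀ * Q) + -(Q * A₂) + -(C₁ᵀ * C₂) = 0 := by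
        rw [← neg_add, ← neg_add, hQ, neg_zero]
      have h21 : -(A₂ᵀ * Qᵀ) + -(Qᵀ * A₁) + -(C₂ᵀ * C₁) = 0 := by
        rw [← neg_add, ← neg_add, hQt, neg_zero]
      rw [fromBlocks_transpose, fromBlocks_multiply, fromBlocks_multiply, transpose_fromCols,
        fromRows_mul_fromCols, fromBlocks_add, fromBlocks_add, ← fromBlocks_zero]
      simp [hQ₁, hQ₂, h12, h21]) hM
  rw [fromBlocks_multiply, ← fromBlocks_zero, fromBlocks_inj] at hQP
  obtain ⟨h11, -, -, h22⟩ := hQP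
  rw [Matrix.neg_mul, ← sub_eq_add_neg, sub_eq_zero] at h11
  rw [Matrix.neg_mul, neg_add_eq_zero] at h22
  rw [Matrix.spectrum_mul_comm_diff_zero P₁, h11, Matrix.spectrum_mul_comm_diff_zero P₂, ← h22,
    Matrix.spectrum_mul_comm_diff_zero Q, ← Matrix.spectrum_transpose_eq (Pᵀ * Q),
    Matrix.transpose_mul, Matrix.transpose_transpose]

section cplx

variable {ι κ ν : Type*}

theorem cplx_mul_s8 [Fintype κ] (M : Matrix ι κ ℝ) (N : Matrix κ ν ℝ) :
    cplx (M * N) = cplx M * cplx N :=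
  Matrix.map_mul (f := Complex.ofRealHom)

theorem cplx_add (M N : Matrix ι κ ℝ) : cplx (M + N) = cplx M + cplx N :=
  Matrix.map_add _ (fun _ _ => Complex.ofReal_add _ _) M N

theorem cplx_zero : cplx (0 : Matrix ι κ ℝ) = 0 :=
  Matrix.map_zero _ Complex.ofReal_zero

theorem cplx_one [DecidableEq ι] : cplx (1 : Matrix ι ι ℝ) = 1 :=
  Matrix.map_one _ Complex.ofReal_zero Complex.ofReal_one

theorem cplx_transpose (M : Matrix ι κ ℝ) : cplx Mᵀ = (cplx M)ᵀ := rfl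

end cplx

theorem stmt8 {n nt m p : ℕ}
    (A : Matrix (Fin n) (Fin n) ℝ) (B : Matrix (Fin n) (Fin m) ℝ)
    (C : Matrix (Fin p) (Fin n) ℝ) (D : Matrix (Fin p) (Fin m) ℝ)
    (hanti : AntistablePair (1 : Matrix (Fin n) (Fin n) ℝ) A)
    (hmin : ∀ (n' : ℕ) (E' A' : Matrix (Fin n') (Fin n') ℝ)
        (B' : Matrix (Fin n') (Fin m) ℝ) (C' : Matrix (Fin p) (Fin n') ℝ)
        (D' : Matrix (Fin p) (Fin m) ℝ),
      RegularPair E' A' →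
      (∀ s : ℂ, IsUnit (s • cplx (1 : Matrix (Fin n) (Fin n) ℝ) - cplx A) →
        IsUnit (s • cplx E' - cplx A') →
        transfer (1 : Matrix (Fin n) (Fin n) ℝ) A B C D s =
          transfer E' A' B' C' D' s) →
      n ≤ n')
    (Et At : Matrix (Fin nt) (Fin nt) ℝ) (Bt : Matrix (Fin nt) (Fin m) ℝ)
    (Ct : Matrix (Fin p) (Fin nt) ℝ) (Dt : Matrix (Fin p) (Fin m) ℝ)
    (htanti : AntistablePair Et At)
    (hagree : ∀ s : ℂ, IsUnit (s • cplx (1 : Matrix (Fin n) (Fin n) ℝ) - cplx A) →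
      IsUnit (s • cplx Et - cplx At) →
      transfer (1 : Matrix (Fin n) (Fin n) ℝ) A B C D s = transfer Et At Bt Ct Dt s)
    (Xc Xo : Matrix (Fin n) (Fin n) ℝ)
    (hX : IsGramians (1 : Matrix (Fin n) (Fin n) ℝ) A B C Xc Xo)
    (Xct Xot : Matrix (Fin nt) (Fin nt) ℝ)
    (hXt : IsGramians Et At Bt Ct Xct Xot) :
    spectrum ℂ (cplx (Xc * Xo)) \ {0} =
      spectrum ℂ (cplx (Xct * Etᵀ * Xot * Et)) \ {0} := by
  have hEu : IsUnit Et.det := (Matrix.isUnit_iff_isUnit_det _).1 htanti.1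
  have hEinv : cplx Et * cplx Et⁻¹ = 1 := by
    rw [← cplx_mul_s8, Matrix.mul_nonsing_inv _ hEu, cplx_one]
  have hEinv' : cplx Et⁻¹ * cplx Et = 1 := by
    rw [← cplx_mul_s8, Matrix.nonsing_inv_mul _ hEu, cplx_one]
  have hfac : ∀ s : ℂ, s • (1 : Matrix (Fin nt) (Fin nt) ℂ) - cplx Et⁻¹ * cplx At =
      cplx Et⁻¹ * (s • cplx Et - cplx At) := by
    intro s
    rw [Matrix.mul_sub, Matrix.mul_smul, hEinv']
  have hA : IsAntistable (cplx A) := by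
    intro s hs
    simpa only [cplx_one] using hanti.2 s hs
  have hAt : IsAntistable (cplx Et⁻¹ * cplx At) := by
    intro s hs
    rw [hfac]
    exact (IsUnit.of_mul_eq_one _ hEinv').mul (htanti.2 s hs)
  obtain ⟨-, -, hc, ho⟩ := hX
  obtain ⟨-, -, hct, hot⟩ := hXt
  have hct' : Et⁻¹ * At * Xct + Xct * (Et⁻¹ * At)ᵀ + Et⁻¹ * Bt * (Et⁻¹ * Bt)ᵀ = 0 := by
    have hEt : Etᵀ * (Et⁻¹)ᵀ = 1 := by
      rw [← Matrix.transpose_mul, Matrix.nonsing_inv_mul _ hEu, Matrix.transpose_one]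
    have h := congrArg (fun M => Et⁻¹ * M * (Et⁻¹)ᵀ) hct
    simp only [Matrix.mul_add, Matrix.add_mul, Matrix.mul_assoc, hEt, Matrix.mul_one,
      Matrix.nonsing_inv_mul_cancel_left _ _ hEu, Matrix.mul_zero, Matrix.zero_mul] at h
    simpa only [Matrix.transpose_mul, Matrix.mul_assoc] using h
  have hot' : (Et⁻¹ * At)ᵀ * (Etᵀ * Xot * Et) + Etᵀ * Xot * Et * (Et⁻¹ * At) + Ctᵀ * Ct = 0 := by
    have h1 : (Et⁻¹ * At)ᵀ * Etᵀ = Atᵀ := by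
      rw [← Matrix.transpose_mul, Matrix.mul_nonsing_inv_cancel_left _ _ hEu]
    rw [← Matrix.mul_assoc, ← Matrix.mul_assoc, h1, Matrix.mul_assoc (Etᵀ * Xot),
      Matrix.mul_nonsing_inv_cancel_left _ _ hEu]
    exact hot
  simp only [Matrix.transpose_one, Matrix.mul_one, Matrix.one_mul] at hc ho
  have hc' := congrArg cplx hc
  have ho' := congrArg cplx ho
  have hct'' := congrArg cplx hct'
  have hot'' := congrArg cplx hot'
  rw [Matrix.mul_assoc (Xct * Etᵀ), Matrix.mul_assoc Xct, ← Matrix.mul_assoc Etᵀ, cplx_mul_s8 Xc,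
    cplx_mul_s8 Xct]
  simp only [cplx_add, cplx_mul_s8, cplx_transpose, cplx_zero] at hc' ho' hct'' hot''
  refine spectrum_gramian_mul_diff_zero_eq (D₁ := cplx D) (D₂ := cplx Dt) hA hAt
    (fun s hs => ?_) hc' ho' hct'' (by simpa only [cplx_mul_s8, cplx_transpose] using hot'')
  have h := hagree s (hanti.2 s hs) (htanti.2 s hs)
  simp only [transfer, cplx_one] at h
  have hinv : (s • (1 : Matrix (Fin nt) (Fin nt) ℂ) - cplx Et⁻¹ * cplx At)⁻¹ * cplx Et⁻¹ =
      (s • cplx Et - cplx At)⁻¹ := by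
    rw [hfac, Matrix.mul_inv_rev, Matrix.inv_eq_left_inv hEinv, Matrix.mul_assoc, hEinv,
      Matrix.mul_one]
  rw [h, ← hinv]
  simp only [Matrix.mul_assoc]

end
end
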